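/- Let S, R ∈ ℝ^{n×n} be symmetric with S ≻ 0 and [[R, I], [I, S]] ≻ 0, and let U, V ∈ ℝ^{n×n} be invertible matrices with V Uᵀ = I − R S. Define Y = [[R, I], [Vᵀ, 0]]. Then: (i) Y is invertible; (ii) the matrix P := [[I, S], [0, Uᵀ]] Y⁻¹ is symmetric and positive definite; (iii) Yᵀ P Y = [[R, I], [I, S]]; (iv) the first block column of P is [S; Uᵀ] (i.e., P [[I], [0]] = [[S], [Uᵀ]]) and the first block column of P⁻¹ is [R; Vᵀ] (i.e., P [[R], [Vᵀ]] = [[I], [0]]). -/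

import Mathlib

open Matrix

theorem isUnit_fromBlocks_one_zero {n α : Type*} [Fintype n] [DecidableEq n] [CommRing α]
    (R : Matrix n n α) {W : Matrix n n α} (hW : IsUnit W) :
    IsUnit (fromBlocks R (1 : Matrix n n α) W 0) := by
  have hW' : IsUnit W.det := (isUnit_iff_isUnit_det W).1 hW
  refine IsUnit.of_mul_eq_one (fromBlocks 0 W⁻¹ 1 (-(R * W⁻¹))) ?_
  simp [fromBlocks_multiply, mul_nonsing_inv W hW', fromBlocks_one]

/-- reconstruction of the storage-function parameter `P` from the
convexified variables. With `S ≻ 0`, `[[R, I], [I, S]] ≻ 0`, invertible `U, V`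
with `V Uᵀ = I − R S`, and `Y = [[R, I], [Vᵀ, 0]]`: (i) `Y` is invertible;
(ii) `P := [[I, S], [0, Uᵀ]] Y⁻¹` is symmetric positive definite;
(iii) `Yᵀ P Y = [[R, I], [I, S]]`; (iv) `P [I; 0] = [S; Uᵀ]` and
`P [R; Vᵀ] = [I; 0]`. -/
theorem statement11 {n : ℕ} (S R U V : Matrix (Fin n) (Fin n) ℝ)
    (hS : S.IsSymm) (hR : R.IsSymm) (hSpd : S.PosDef)
    (hblk : (fromBlocks R (1 : Matrix (Fin n) (Fin n) ℝ)
      (1 : Matrix (Fin n) (Fin n) ℝ) S).PosDef)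
    (hU : IsUnit U) (hV : IsUnit V)
    (hVU : V * Uᵀ = 1 - R * S) :
    IsUnit (fromBlocks R (1 : Matrix (Fin n) (Fin n) ℝ) Vᵀ 0) ∧
    (fromBlocks (1 : Matrix (Fin n) (Fin n) ℝ) S 0 Uᵀ *
        (fromBlocks R (1 : Matrix (Fin n) (Fin n) ℝ) Vᵀ 0)⁻¹).IsSymm ∧
    (fromBlocks (1 : Matrix (Fin n) (Fin n) ℝ) S 0 Uᵀ *
        (fromBlocks R (1 : Matrix (Fin n) (Fin n) ℝ) Vᵀ 0)⁻¹).PosDef ∧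
    (fromBlocks R (1 : Matrix (Fin n) (Fin n) ℝ) Vᵀ 0)ᵀ *
        (fromBlocks (1 : Matrix (Fin n) (Fin n) ℝ) S 0 Uᵀ *
          (fromBlocks R (1 : Matrix (Fin n) (Fin n) ℝ) Vᵀ 0)⁻¹) *
        fromBlocks R (1 : Matrix (Fin n) (Fin n) ℝ) Vᵀ 0 =
      fromBlocks R 1 1 S ∧
    (fromBlocks (1 : Matrix (Fin n) (Fin n) ℝ) S 0 Uᵀ *
        (fromBlocks R (1 : Matrix (Fin n) (Fin n) ℝ) Vᵀ 0)⁻¹) *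
        fromRows (1 : Matrix (Fin n) (Fin n) ℝ) 0 =
      fromRows S Uᵀ ∧
    (fromBlocks (1 : Matrix (Fin n) (Fin n) ℝ) S 0 Uᵀ *
        (fromBlocks R (1 : Matrix (Fin n) (Fin n) ℝ) Vᵀ 0)⁻¹) *
        fromRows R Vᵀ =
      fromRows (1 : Matrix (Fin n) (Fin n) ℝ) 0 := by
  have hY := isUnit_fromBlocks_one_zero R ((isUnit_transpose V).2 hV)
  have hYB : (fromBlocks R (1 : Matrix (Fin n) (Fin n) ℝ) Vᵀ 0)ᵀ *
      fromBlocks (1 : Matrix (Fin n) (Fin n) ℝ) S 0 Uᵀ = fromBlocks R 1 1 S := by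
    simp [fromBlocks_transpose, fromBlocks_multiply, hR.eq, hVU]
  have hYcols : fromBlocks R (1 : Matrix (Fin n) (Fin n) ℝ) Vᵀ 0 =
      fromCols (fromRows R Vᵀ) (fromRows 1 0) :=
    (fromCols_fromRows_eq_fromBlocks R 1 Vᵀ 0).symm
  have hBcols : fromBlocks (1 : Matrix (Fin n) (Fin n) ℝ) S 0 Uᵀ =
      fromCols (fromRows 1 0) (fromRows S Uᵀ) :=
    (fromCols_fromRows_eq_fromBlocks 1 S 0 Uᵀ).symm
  generalize fromBlocks (1 : Matrix (Fin n) (Fin n) ℝ) S 0 Uᵀ = B at hYB hBcols ⊢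
  generalize fromBlocks R (1 : Matrix (Fin n) (Fin n) ℝ) Vᵀ 0 = Y at hY hYB hYcols ⊢
  have hPY : B * Y⁻¹ * Y = B :=
    nonsing_inv_mul_cancel_right Y B ((isUnit_iff_isUnit_det Y).1 hY)
  have hcong : Yᵀ * (B * Y⁻¹) * Y = fromBlocks R 1 1 S := by
    rw [Matrix.mul_assoc, hPY, hYB]
  have hP : (B * Y⁻¹).PosDef := by
    rw [← hcong] at hblk
    exact (Matrix.IsUnit.posDef_star_left_conjugate_iff hY).1 hblk
  have hcols := mul_fromCols (B * Y⁻¹) (fromRows R Vᵀ)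
    (fromRows (1 : Matrix (Fin n) (Fin n) ℝ) 0)
  rw [← hYcols, hPY] at hcols
  obtain ⟨hfst, hsnd⟩ := fromCols_inj (hBcols.symm.trans hcols)
  exact ⟨hY, hP.isHermitian, hP, hcong, hsnd.symm, hfst.symm⟩
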